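/- arXiv:2603.04137 — 8 statements merged into one kernel-verified Lean document; each statement's English description precedes it below -/
import Mathlib

section
/- For every n ≥ 1, the sum ∑_{k=0}^{n-1} v(n,k) equals the central binomial coefficient C(n, ⌊n/2⌋); equivalently, c_n(1) = C(n, ⌊n/2⌋). -/
open Polynomial Finset

/-- `v n k = C(⌊(n-1)/2⌋, ⌊k/2⌋) * C(⌊n/2⌋, ⌊(k+1)/2⌋)` -/
def v (n k : ℕ) : ℕ := Nat.choose ((n - 1) / 2) (k / 2) * Nat.choose (n / 2) ((k + 1) / 2)

/-- The polynomials `c n`, i.e. the q-Narayana polynomials at q = -1. -/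
noncomputable def c : ℕ → Polynomial ℤ
  | 0 => 1
  | n + 1 => ∑ k ∈ Finset.range (n + 1), Polynomial.C (v (n + 1) k : ℤ) * Polynomial.X ^ k


theorem sum_choose_half_mul_choose_half (a b m : ℕ) :
    ∑ k ∈ Finset.range (2 * m), a.choose (k / 2) * b.choose ((k + 1) / 2) =
      ∑ i ∈ Finset.range m, a.choose i * (b + 1).choose (i + 1) := by
  induction m with
  | zero => simp
  | succ m ih =>
    rw [show 2 * (m + 1) = 2 * m + 1 + 1 by ring, Finset.sum_range_succ, Finset.sum_range_succ, ih,
      Finset.sum_range_succ, show (2 * m + 1) / 2 = m by omega, show 2 * m / 2 = m by omega,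
      show (2 * m + 1 + 1) / 2 = m + 1 by omega, Nat.choose_succ_succ b m]
    ring

theorem sum_choose_mul_choose_succ (m b : ℕ) :
    ∑ i ∈ Finset.range (m + 1), m.choose i * b.choose (i + 1) = (m + b).choose (m + 1) := by
  rw [Nat.add_choose_eq, Finset.Nat.sum_antidiagonal_eq_sum_range_succ
    (fun x y => m.choose x * b.choose y), Finset.sum_range_succ _ (m + 1),
    Nat.choose_succ_self, zero_mul, add_zero, ← Finset.sum_range_reflect]
  refine Finset.sum_congr rfl fun i hi => ?_
  have hi : i ≤ m := by simpa [Nat.lt_succ_iff] using hi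
  rw [show m + 1 - 1 - i = m - i by omega, Nat.choose_symm hi, show m - i + 1 = m + 1 - i by omega]

theorem sum_v (n : ℕ) (hn : 1 ≤ n) : ∑ k ∈ Finset.range n, v n k = n.choose (n / 2) := by
  unfold v
  obtain ⟨m, rfl | rfl⟩ : ∃ m, n = 2 * m + 1 ∨ n = 2 * (m + 1) := ⟨(n - 1) / 2, by omega⟩
  · rw [show (2 * m + 1 - 1) / 2 = m by omega, show (2 * m + 1) / 2 = m by omega]
    have h := sum_choose_half_mul_choose_half m m (m + 1)
    rw [sum_choose_mul_choose_succ, show 2 * (m + 1) = 2 * m + 1 + 1 by ring,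
      Finset.sum_range_succ, show (2 * m + 1 + 1) / 2 = m + 1 by omega, Nat.choose_succ_self,
      mul_zero, add_zero] at h
    rw [h, show m + (m + 1) = 2 * m + 1 by ring, Nat.choose_symm_half]
  · rw [show (2 * (m + 1) - 1) / 2 = m by omega, show 2 * (m + 1) / 2 = m + 1 by omega,
      sum_choose_half_mul_choose_half, sum_choose_mul_choose_succ]
    congr 1
    ring

theorem eval_one_c (n : ℕ) (hn : 1 ≤ n) :
    (c n).eval 1 = ((∑ k ∈ Finset.range n, v n k : ℕ) : ℤ) := by
  obtain ⟨n, rfl⟩ := Nat.exists_eq_add_of_le' hn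
  simp [c, Polynomial.eval_finsetSum]

/-- For every `n ≥ 1`, `∑_{k=0}^{n-1} v(n,k) = C(n, ⌊n/2⌋)`; equivalently
`c_n(1) = C(n, ⌊n/2⌋)`. -/
theorem statement0 (n : ℕ) (hn : 1 ≤ n) :
    (∑ k ∈ Finset.range n, v n k) = Nat.choose n (n / 2) ∧
      (c n).eval 1 = (Nat.choose n (n / 2) : ℤ) := by
  exact ⟨sum_v n hn, by rw [eval_one_c n hn, sum_v n hn]⟩
end

section
/- For every n ≥ 1, the polynomial identity c_{2n}(t) = (1 + t) · c_{2n-1}(t) holds in ℤ[t]. -/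
open Polynomial Finset

theorem v_succ_eq_zero {n k : ℕ} (h : n + 1 ≤ k) : v (n + 1) k = 0 := by
  unfold v
  rcases Nat.even_or_odd' n with ⟨m, rfl | rfl⟩
  · rw [Nat.choose_eq_zero_of_lt (k := (k + 1) / 2) (by omega), mul_zero]
  · rw [Nat.choose_eq_zero_of_lt (k := k / 2) (by omega), zero_mul]

theorem coeff_c_succ (n k : ℕ) : (c (n + 1)).coeff k = v (n + 1) k := by
  simp only [c, finsetSum_coeff, coeff_C_mul_X_pow, Finset.sum_ite_eq, Finset.mem_range]
  split_ifs with h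
  · rfl
  · rw [v_succ_eq_zero (not_lt.mp h), Nat.cast_zero]

theorem v_even_zero (m : ℕ) : v (2 * m + 1 + 1) 0 = v (2 * m + 1) 0 := by
  simp [v]

theorem v_even_succ (m k : ℕ) :
    v (2 * m + 1 + 1) (k + 1) = v (2 * m + 1) (k + 1) + v (2 * m + 1) k := by
  have h₁ : (2 * m + 1 + 1 - 1) / 2 = m := by omega
  have h₂ : (2 * m + 1 + 1) / 2 = m + 1 := by omega
  have h₃ : (2 * m + 1 - 1) / 2 = m := by omega
  have h₄ : (2 * m + 1) / 2 = m := by omega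
  have h₅ : (k + 1 + 1) / 2 = k / 2 + 1 := by omega
  simp only [v, h₁, h₂, h₃, h₄, h₅, Nat.choose_succ_succ']
  rcases Nat.even_or_odd' k with ⟨j, rfl | rfl⟩
  · have h₆ : (2 * j + 1) / 2 = j := by omega
    have h₇ : 2 * j / 2 = j := by omega
    rw [h₆, h₇]
    ring
  · have h₆ : (2 * j + 1 + 1) / 2 = j + 1 := by omega
    have h₇ : (2 * j + 1) / 2 = j := by omega
    rw [h₆, h₇]
    ring

/-- For every `n ≥ 1`, `c_{2n}(t) = (1 + t) * c_{2n-1}(t)` in `ℤ[t]`. -/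
theorem statement1 (n : ℕ) (hn : 1 ≤ n) :
    c (2 * n) = (1 + Polynomial.X) * c (2 * n - 1) := by
  obtain ⟨m, rfl⟩ := Nat.exists_eq_add_of_le' hn
  rw [show 2 * (m + 1) = 2 * m + 1 + 1 by ring, Nat.add_sub_cancel]
  ext k
  rw [add_mul, one_mul, coeff_add, coeff_c_succ, coeff_c_succ]
  cases k with
  | zero => rw [coeff_X_mul_zero, add_zero, v_even_zero]
  | succ k => rw [coeff_X_mul, coeff_c_succ, v_even_succ, Nat.cast_add]
end

section
/- For every n ≥ 0, the polynomial identity c_{2n+1}(t) = (1 + t) · c_{2n}(t) - t · C_n(t²) holds in ℤ[t], where C_n(t²) denotes the Narayana polynomial C_n with t replaced by t². -/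
open Polynomial Finset

/-- The Narayana numbers `N(n,k) = C(n,k)*C(n-1,k)/(k+1)`. -/
def naraNum (n k : ℕ) : ℕ := Nat.choose n k * Nat.choose (n - 1) k / (k + 1)

/-- The Narayana polynomials. -/
noncomputable def naraPoly : ℕ → Polynomial ℤ
  | 0 => 1
  | n + 1 => ∑ k ∈ Finset.range (n + 1), Polynomial.C (naraNum (n + 1) k : ℤ) * Polynomial.X ^ k

/-- The Narayana polynomials of type B. -/
noncomputable def naraB (n : ℕ) : Polynomial ℤ :=
  ∑ k ∈ Finset.range (n + 1), Polynomial.C ((Nat.choose n k : ℤ) ^ 2) * Polynomial.X ^ k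

theorem coeff_sum_C_mul_X_pow (f : ℕ → ℤ) (n k : ℕ) (hf : ∀ i, n ≤ i → f i = 0) :
    (∑ i ∈ Finset.range n, Polynomial.C (f i) * Polynomial.X ^ i).coeff k = f k := by
  simp only [finsetSum_coeff, coeff_C_mul_X_pow, Finset.sum_ite_eq, Finset.mem_range]
  split_ifs with h
  · rfl
  · exact (hf k (not_lt.mp h)).symm

theorem v_eq_zero {n k : ℕ} (hn : 0 < n) (h : n ≤ k) : v n k = 0 := by
  rw [v, Nat.mul_eq_zero, Nat.choose_eq_zero_iff, Nat.choose_eq_zero_iff]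
  omega

theorem coeff_c {n : ℕ} (hn : 0 < n) (k : ℕ) : (c n).coeff k = v n k := by
  obtain ⟨m, rfl⟩ := Nat.exists_eq_add_of_lt hn
  rw [Nat.zero_add, c]
  refine coeff_sum_C_mul_X_pow (fun i ↦ (v (m + 1) i : ℤ)) (m + 1) k fun i hi ↦ ?_
  simp [v_eq_zero m.succ_pos hi]

theorem coeff_naraPoly_succ (n k : ℕ) : (naraPoly (n + 1)).coeff k = naraNum (n + 1) k := by
  rw [naraPoly]
  refine coeff_sum_C_mul_X_pow (fun i ↦ (naraNum (n + 1) i : ℤ)) (n + 1) k fun i hi ↦ ?_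
  simp [naraNum, Nat.choose_eq_zero_of_lt (show n < i by omega)]

theorem naraNum_succ_add (n k : ℕ) :
    naraNum (n + 1) k + (n + 1).choose k * (n + 1).choose (k + 1) =
      n.choose k * (n + 2).choose (k + 1) := by
  have h₁ : (n + 1) * n.choose k = (n + 1).choose (k + 1) * (k + 1) :=
    Nat.add_one_mul_choose_eq n k
  have h₂ : (n + 2) * (n + 1).choose k = (n + 2).choose (k + 1) * (k + 1) :=
    Nat.add_one_mul_choose_eq (n + 1) k
  have key : (n + 1).choose k * n.choose k +
      (k + 1) * ((n + 1).choose k * (n + 1).choose (k + 1)) =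
        (k + 1) * (n.choose k * (n + 2).choose (k + 1)) := by
    linear_combination n.choose k * h₂ - (n + 1).choose k * h₁
  rw [naraNum, Nat.add_sub_cancel, ← Nat.add_mul_div_left _ _ k.succ_pos, Nat.succ_eq_add_one,
    key, Nat.mul_div_cancel_left _ k.succ_pos]

theorem v_odd_zero (n : ℕ) : v (2 * (n + 1) + 1) 0 = v (2 * (n + 1)) 0 := by
  simp [v]

theorem v_odd_even (n j : ℕ) :
    v (2 * (n + 1) + 1) (2 * j + 2) =
      v (2 * (n + 1)) (2 * j + 2) + v (2 * (n + 1)) (2 * j + 1) := by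
  simp only [v, show (2 * (n + 1) + 1 - 1) / 2 = n + 1 by omega,
    show (2 * (n + 1) + 1) / 2 = n + 1 by omega, show (2 * (n + 1) - 1) / 2 = n by omega,
    show 2 * (n + 1) / 2 = n + 1 by omega, show (2 * j + 2) / 2 = j + 1 by omega,
    show (2 * j + 2 + 1) / 2 = j + 1 by omega, show (2 * j + 1) / 2 = j by omega]
  rw [← add_mul, Nat.choose_succ_succ' n j, add_comm (n.choose j)]

theorem v_odd_odd (n j : ℕ) :
    v (2 * (n + 1) + 1) (2 * j + 1) + naraNum (n + 1) j =
      v (2 * (n + 1)) (2 * j + 1) + v (2 * (n + 1)) (2 * j) := by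
  simp only [v, show (2 * (n + 1) + 1 - 1) / 2 = n + 1 by omega,
    show (2 * (n + 1) + 1) / 2 = n + 1 by omega, show (2 * (n + 1) - 1) / 2 = n by omega,
    show 2 * (n + 1) / 2 = n + 1 by omega, show 2 * j / 2 = j by omega,
    show (2 * j + 1) / 2 = j by omega, show (2 * j + 1 + 1) / 2 = j + 1 by omega]
  rw [add_comm, naraNum_succ_add, ← mul_add, Nat.choose_succ_succ' (n + 1) j,
    add_comm ((n + 1).choose j)]

/-- For every `n ≥ 0`, `c_{2n+1}(t) = (1 + t) * c_{2n}(t) - t * C_n(t²)` in `ℤ[t]`. -/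
theorem statement2 (n : ℕ) :
    c (2 * n + 1) =
      (1 + Polynomial.X) * c (2 * n) -
        Polynomial.X * (naraPoly n).comp (Polynomial.X ^ 2) := by
  cases n with
  | zero => simp [c, naraPoly, v]
  | succ n =>
    have hc : (naraPoly (n + 1)).comp (Polynomial.X ^ 2) = expand ℤ 2 (naraPoly (n + 1)) :=
      (expand_eq_comp_X_pow 2).symm
    rw [hc]
    ext k
    cases k with
    | zero => simp [coeff_c, v_odd_zero, add_mul]
    | succ k =>
      rw [add_mul, one_mul, coeff_sub, coeff_add, coeff_X_mul, coeff_X_mul,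
        coeff_c (by omega), coeff_c (by omega), coeff_c (by omega), coeff_expand two_pos]
      obtain ⟨j, rfl | rfl⟩ := k.even_or_odd'
      · rw [if_pos (dvd_mul_right 2 j), Nat.mul_div_cancel_left j two_pos, coeff_naraPoly_succ,
          eq_sub_iff_add_eq]
        exact_mod_cast v_odd_odd n j
      · rw [if_neg (by omega), sub_zero]
        exact_mod_cast v_odd_even n j
end

section
/- For every n ≥ 1, the evaluation of c_{2n} at t = -1 is zero: c_{2n}(-1) = 0. -/
open Polynomial Finset

theorem v_even_reflect (m k : ℕ) (hk : k < 2 * m + 2) :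
    v (2 * m + 2) (2 * m + 1 - k) = v (2 * m + 2) k := by
  unfold v
  have h₁ : (2 * m + 1 - k) / 2 = m - k / 2 := by omega
  have h₂ : (2 * m + 1 - k + 1) / 2 = m + 1 - (k + 1) / 2 := by omega
  rw [h₁, h₂, show (2 * m + 2 - 1) / 2 = m by omega, show (2 * m + 2) / 2 = m + 1 by omega,
    Nat.choose_symm (by omega), Nat.choose_symm (by omega)]

/-- For every `n ≥ 1`, `c_{2n}(-1) = 0`. -/
theorem statement3 (n : ℕ) (hn : 1 ≤ n) : (c (2 * n)).eval (-1) = 0 := by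
  obtain ⟨m, rfl⟩ : ∃ m, n = m + 1 := ⟨n - 1, by omega⟩
  have h : (c (2 * (m + 1))).eval (-1) =
      ∑ k ∈ Finset.range (2 * m + 2), (v (2 * m + 2) k : ℤ) * (-1) ^ k := by
    rw [show 2 * (m + 1) = (2 * m + 1) + 1 by ring, c]
    simp [Polynomial.eval_finsetSum]
  rw [h]
  have h_neg : ∑ k ∈ Finset.range (2 * m + 2), (v (2 * m + 2) k : ℤ) * (-1) ^ k =
      -∑ k ∈ Finset.range (2 * m + 2), (v (2 * m + 2) k : ℤ) * (-1) ^ k := by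
    conv_lhs => rw [← Finset.sum_range_reflect]
    rw [← Finset.sum_neg_distrib]
    refine Finset.sum_congr rfl fun k hk => ?_
    have hk' := Finset.mem_range.mp hk
    rw [show 2 * m + 2 - 1 - k = 2 * m + 1 - k by omega, v_even_reflect m k hk']
    rcases Nat.even_or_odd k with hp | hp
    · have hq : Odd (2 * m + 1 - k) := by grind
      rw [hp.neg_one_pow, hq.neg_one_pow]
      ring
    · have hq : Even (2 * m + 1 - k) := by grind
      rw [hp.neg_one_pow, hq.neg_one_pow]
      ring
  linarith
end

section
/- For every n ≥ 0, the evaluation of c_{2n+1} at t = -1 equals the n-th Catalan number: c_{2n+1}(-1) = C_n = (1/(n+1))·C(2n,n). -/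
open Polynomial Finset

theorem sum_range_choose_mul_choose_succ (n : ℕ) :
    ∑ j ∈ range n, n.choose j * n.choose (j + 1) = (2 * n).choose (n + 1) := by
  rw [two_mul, Nat.add_choose_eq, Nat.sum_antidiagonal_eq_sum_range_succ_mk, sum_range_succ',
    sum_range_succ]
  simp only [Nat.choose_succ_self, zero_mul, add_zero, Nat.sub_zero, mul_zero]
  refine sum_congr rfl fun j hj => ?_
  have hjn : j ≤ n := (mem_range.mp hj).le
  rw [Nat.add_sub_add_right, Nat.choose_symm hjn, mul_comm]

theorem centralBinom_sub_choose_succ (n : ℕ) :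
    (n.centralBinom : ℤ) - (2 * n).choose (n + 1) = catalan n := by
  have h₁ : ((n : ℤ) + 1) * catalan n = n.centralBinom := by
    exact_mod_cast succ_mul_catalan_eq_centralBinom n
  have h₂ : ((2 * n).choose (n + 1) : ℤ) * (n + 1) = n.centralBinom * n := by
    have h := Nat.choose_succ_right_eq (2 * n) n
    rw [show 2 * n - n = n by omega, ← Nat.centralBinom_eq_two_mul_choose] at h
    exact_mod_cast h
  have h₀ : (n : ℤ) + 1 ≠ 0 := by positivity
  apply mul_left_cancel₀ h₀
  linear_combination -h₂ - h₁

theorem sum_range_choose_half_mul_neg_one_pow (n m : ℕ) :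
    ∑ k ∈ range (2 * m + 1),
        ((n.choose (k / 2) * n.choose ((k + 1) / 2) : ℕ) : ℤ) * (-1) ^ k =
      ((∑ j ∈ range (m + 1), n.choose j ^ 2 : ℕ) : ℤ) -
        ((∑ j ∈ range m, n.choose j * n.choose (j + 1) : ℕ) : ℤ) := by
  induction m with
  | zero => simp
  | succ m ih =>
    rw [show 2 * (m + 1) + 1 = 2 * m + 1 + 1 + 1 by ring, sum_range_succ, sum_range_succ, ih,
      sum_range_succ _ (m + 1), sum_range_succ _ m,
      show (2 * m + 1) / 2 = m by omega, show (2 * m + 1 + 1) / 2 = m + 1 by omega,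
      show (2 * m + 1 + 1 + 1) / 2 = m + 1 by omega]
    have h : ((-1 : ℤ)) ^ (2 * m) = 1 := by simp
    simp only [pow_succ (-1 : ℤ), h]
    rw [sum_range_succ _ m]
    push_cast
    ring

/-- For every `n ≥ 0`, `c_{2n+1}(-1)` equals the `n`-th Catalan number. -/
theorem statement4 (n : ℕ) : (c (2 * n + 1)).eval (-1) = (catalan n : ℤ) := by
  simp only [c, v, eval_finsetSum, eval_mul, eval_C, eval_pow, eval_X]
  rw [show (2 * n + 1 - 1) / 2 = n by omega, show (2 * n + 1) / 2 = n by omega,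
    sum_range_choose_half_mul_neg_one_pow, Nat.sum_range_choose_sq,
    sum_range_choose_mul_choose_succ, ← Nat.centralBinom_eq_two_mul_choose,
    centralBinom_sub_choose_succ]
end

section
/- In the ring of formal power series in z over ℤ[t], the product identity c(t,z) · c(-t,-z) = C(t²,z²) holds; that is, ∑_{n≥0} (∑_{i+j=n} (-1)^j c_i(t) c_j(-t)) z^n equals the series whose coefficient of z^{2n} is the Narayana polynomial C_n(t²) and whose odd coefficients vanish. -/
open Polynomial Finset

section Walks

variable {R : Type*} [CommRing R]

/-- The coefficient of `a ^ k` in `((1 + a) * (1 + y / a)) ^ m`. -/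
def walkSum (y : R) (k m : ℕ) : R :=
  ∑ j ∈ range (m + 1), ((m.choose (j + k) * m.choose j : ℕ) : R) * y ^ j

theorem walkSum_eq_sum_range_add (y : R) (k m r : ℕ) :
    walkSum y k m =
      ∑ j ∈ range (m + 1 + r), ((m.choose (j + k) * m.choose j : ℕ) : R) * y ^ j := by
  rw [walkSum]
  refine sum_subset (range_subset_range.2 (by omega)) fun j _ hj => ?_
  rw [Nat.choose_eq_zero_of_lt (k := j) (by simpa using hj)]
  simp

theorem walkSum_zero_right (y : R) (k : ℕ) : walkSum y k 0 = if k = 0 then 1 else 0 := by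
  cases k <;> simp [walkSum]

theorem mul_walkSum_succ (y : R) (k m : ℕ) :
    y * walkSum y (k + 1) m =
      ∑ j ∈ range (m + 1), ((m.choose (j + 1 + k) * m.choose j : ℕ) : R) * y ^ (j + 1) := by
  rw [walkSum, mul_sum]
  refine sum_congr rfl fun j _ => ?_
  rw [show j + (k + 1) = j + 1 + k by ring]
  ring

theorem walkSum_eq_choose_add (y : R) (k m : ℕ) :
    walkSum y k m = m.choose k +
      ∑ j ∈ range (m + 1),
        ((m.choose (j + 1 + k) * m.choose (j + 1) : ℕ) : R) * y ^ (j + 1) := by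
  rw [walkSum_eq_sum_range_add y k m 1, sum_range_succ']
  simp [add_comm]

theorem walkSum_succ_succ (y : R) (k m : ℕ) :
    walkSum y (k + 1) (m + 1) =
      (1 + y) * walkSum y (k + 1) m + walkSum y k m + y * walkSum y (k + 2) m := by
  have h : (1 + y) * walkSum y (k + 1) m + walkSum y k m + y * walkSum y (k + 2) m =
      walkSum y (k + 1) m + walkSum y k m + y * walkSum y (k + 2) m +
        y * walkSum y (k + 1) m := by ring
  rw [h, mul_walkSum_succ y (k + 1), mul_walkSum_succ, walkSum_eq_choose_add y (k + 1) m,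
    walkSum_eq_choose_add y k m, walkSum, sum_range_succ']
  have e (j : ℕ) : (((m + 1).choose (j + 1 + (k + 1)) * (m + 1).choose (j + 1) : ℕ) : R) *
      y ^ (j + 1) =
      ((m.choose (j + 1 + (k + 1)) * m.choose (j + 1) : ℕ) : R) * y ^ (j + 1) +
      ((m.choose (j + 1 + k) * m.choose (j + 1) : ℕ) : R) * y ^ (j + 1) +
      ((m.choose (j + 1 + (k + 1)) * m.choose j : ℕ) : R) * y ^ (j + 1) +
      ((m.choose (j + 1 + k) * m.choose j : ℕ) : R) * y ^ (j + 1) := by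
    rw [← add_assoc (j + 1) k 1, Nat.choose_succ_succ m (j + 1 + k), Nat.choose_succ_succ m j]
    push_cast
    ring
  simp only [e, sum_add_distrib]
  simp only [zero_add, Nat.choose_succ_succ m k, Nat.choose_zero_right, pow_zero]
  push_cast
  ring

theorem walkSum_zero_succ (y : R) (m : ℕ) :
    walkSum y 0 (m + 1) = (1 + y) * walkSum y 0 m + 2 * y * walkSum y 1 m := by
  have h : (1 + y) * walkSum y 0 m + 2 * y * walkSum y 1 m =
      walkSum y 0 m + 2 * (y * walkSum y 1 m) + y * walkSum y 0 m := by ring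
  have h0 : y * walkSum y 0 m =
      ∑ j ∈ range (m + 1), ((m.choose j * m.choose j : ℕ) : R) * y ^ (j + 1) := by
    rw [walkSum, mul_sum]
    exact sum_congr rfl fun j _ => by rw [add_zero]; ring
  rw [h, h0, mul_walkSum_succ, walkSum_eq_choose_add y 0 m, walkSum, sum_range_succ']
  have e (j : ℕ) : (((m + 1).choose (j + 1 + 0) * (m + 1).choose (j + 1) : ℕ) : R) *
      y ^ (j + 1) =
      ((m.choose (j + 1 + 0) * m.choose (j + 1) : ℕ) : R) * y ^ (j + 1) +
      2 * (((m.choose (j + 1 + 0) * m.choose j : ℕ) : R) * y ^ (j + 1)) +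
      ((m.choose j * m.choose j : ℕ) : R) * y ^ (j + 1) := by
    rw [add_zero, Nat.choose_succ_succ m j]
    push_cast
    ring
  simp only [e, sum_add_distrib, ← mul_sum]
  simp
  ring

end Walks

section Series

variable {R : Type*} [CommRing R]

/-- The coefficients of the solution of `g = x * (1 + g) * (1 + y * g)`. -/
def naraCoeff (y : R) : ℕ → R
  | 0 => 0
  | n + 1 => (if n = 0 then 1 else 0) + (1 + y) * naraCoeff y n +
      y * ∑ i : Fin (n + 1), naraCoeff y i * naraCoeff y (n - i)

theorem mk_naraCoeff (y : R) :
    PowerSeries.mk (naraCoeff y) = PowerSeries.X * (1 + PowerSeries.mk (naraCoeff y)) *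
      (1 + PowerSeries.C y * PowerSeries.mk (naraCoeff y)) := by
  set g := PowerSeries.mk (naraCoeff y) with hg
  have h : PowerSeries.X * (1 + g) * (1 + PowerSeries.C y * g) =
      PowerSeries.X * (1 + (g + PowerSeries.C y * g) + PowerSeries.C y * (g * g)) := by ring
  rw [h]
  ext n
  cases n with
  | zero => simp [hg, naraCoeff]
  | succ n =>
    rw [PowerSeries.coeff_succ_X_mul]
    simp only [map_add, PowerSeries.coeff_C_mul, PowerSeries.coeff_one, hg, PowerSeries.coeff_mk]
    rw [PowerSeries.coeff_mul]
    simp only [PowerSeries.coeff_mk]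
    rw [naraCoeff, Finset.Nat.sum_antidiagonal_eq_sum_range_succ
      (fun i j => naraCoeff y i * naraCoeff y j), Finset.sum_range]
    ring

theorem mk_walkSum {y : R} {B g : PowerSeries R}
    (hg : g = PowerSeries.X * (1 + g) * (1 + PowerSeries.C y * g))
    (hB : B * (1 - PowerSeries.X * (1 + PowerSeries.C y) -
      2 * PowerSeries.X * PowerSeries.C y * g) = 1) (k : ℕ) :
    PowerSeries.mk (walkSum y k) = B * g ^ k := by
  have hg0 : PowerSeries.constantCoeff g = 0 := by rw [hg]; simp
  have hB0 : PowerSeries.constantCoeff B = 1 := by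
    simpa using congrArg PowerSeries.constantCoeff hB
  ext m
  induction m generalizing k with
  | zero =>
    simp [walkSum_zero_right, hg0, hB0, zero_pow_eq]
  | succ m ih =>
    simp only [PowerSeries.coeff_mk] at ih ⊢
    cases k with
    | zero =>
      have h : B * g ^ 0 = 1 + PowerSeries.X * (B * g ^ 0 + PowerSeries.C y * (B * g ^ 0) +
          PowerSeries.C y * (B * g ^ 1) + PowerSeries.C y * (B * g ^ 1)) := by
        linear_combination hB
      rw [h, walkSum_zero_succ, map_add, PowerSeries.coeff_succ_X_mul]
      simp only [map_add, PowerSeries.coeff_C_mul, ← ih, PowerSeries.coeff_one]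
      simp
      ring
    | succ k =>
      have h : B * g ^ (k + 1) = PowerSeries.X * (B * g ^ (k + 1) +
          PowerSeries.C y * (B * g ^ (k + 1)) + B * g ^ k +
          PowerSeries.C y * (B * g ^ (k + 2))) := by
        linear_combination B * g ^ k * hg
      rw [h, walkSum_succ_succ, PowerSeries.coeff_succ_X_mul]
      simp only [map_add, PowerSeries.coeff_C_mul, ← ih]
      ring

/-- Let `F k` be the generating function of `walkSum y k`. With `x = z ^ 2` and `y = t ^ 2`,
`c(t, z)` is `1 + x * (F 0 + y * F 1) + t * x * (F 0 + F 1) + z * (F 0 + t * F 1)`. -/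
theorem mk_walkSum_product_identities (y : R) :
    let x : PowerSeries R := PowerSeries.X
    let F := fun k => PowerSeries.mk (walkSum y k)
    let Y := PowerSeries.C y
    (1 + x * (F 0 + Y * F 1)) * F 1 = x * (F 0 + F 1) * F 0 ∧
      (1 + x * (F 0 + Y * F 1)) ^ 2 + x * Y * F 1 ^ 2 - Y * (x * (F 0 + F 1)) ^ 2 - x * F 0 ^ 2 =
        1 + x * (F 0 - Y * F 2) := by
  intro x F Y
  set g := PowerSeries.mk (naraCoeff y)
  have hg : g = x * (1 + g) * (1 + Y * g) := mk_naraCoeff y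
  obtain ⟨B, hB⟩ : ∃ B, B * (1 - x * (1 + Y) - 2 * x * Y * g) = 1 := by
    refine IsUnit.exists_left_inv (PowerSeries.isUnit_iff_constantCoeff.2 ?_)
    simp [x]
  have hF (k : ℕ) : F k = B * g ^ k := mk_walkSum hg hB k
  rw [hF, hF, hF, pow_zero, pow_one, mul_one]
  have h1 : x * B * (1 - Y * g ^ 2) = g := by linear_combination -B * hg + g * hB
  have h2 : (1 + x * (B + Y * (B * g))) * (1 + Y * g) = B := by
    linear_combination B * Y * hg - (1 + Y * g) * hB
  have h3 : (1 + x * (B + Y * (B * g))) * (1 - Y * g ^ 2) = 1 + g := by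
    linear_combination (1 + Y * g) * h1
  have h4 : (1 + x * (B + Y * (B * g))) * g = x * (B + B * g) := by linear_combination -h1
  refine ⟨by linear_combination B * h4, ?_⟩
  generalize hE : 1 + x * (B + Y * (B * g)) = E at *
  rw [← h4]
  linear_combination (E * (1 - x * (1 + Y * g) ^ 2) + 1) * h3 + E * (1 + Y * g) * hg +
    x * (1 - Y * g ^ 2) * (E * (1 + Y * g) + B) * h2 - h1

end Series

theorem sum_range_two_mul {M : Type*} [AddCommMonoid M] (f : ℕ → M) (n : ℕ) :
    ∑ k ∈ range (2 * n), f k = ∑ j ∈ range n, (f (2 * j) + f (2 * j + 1)) := by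
  induction n with
  | zero => simp
  | succ n ih => rw [Nat.mul_succ, sum_range_succ, sum_range_succ, ih, sum_range_succ, add_assoc]

theorem c_two_mul_add_one (m : ℕ) :
    c (2 * m + 1) = walkSum (X ^ 2) 0 m + X * walkSum (X ^ 2) 1 m := by
  have h : c (2 * m + 1) =
      ∑ k ∈ range (2 * (m + 1)), Polynomial.C (v (2 * m + 1) k : ℤ) * X ^ k := by
    rw [Nat.mul_succ, sum_range_succ, c]
    have : v (2 * m + 1) (2 * m + 1) = 0 := by
      simp [v, show (2 * m + 1 + 1) / 2 = m + 1 by omega, show (2 * m + 1) / 2 = m by omega]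
    simp [this]
  rw [h, sum_range_two_mul, walkSum, walkSum, mul_sum, ← sum_add_distrib]
  refine sum_congr rfl fun j _ => ?_
  simp only [v, show (2 * m + 1 - 1) / 2 = m by omega, show (2 * m + 1) / 2 = m by omega,
    show 2 * j / 2 = j by omega, show (2 * j + 1) / 2 = j by omega,
    show (2 * j + 1 + 1) / 2 = j + 1 by omega]
  simp
  ring

theorem c_two_mul_add_two (m : ℕ) :
    c (2 * m + 2) = walkSum (X ^ 2) 0 m + X ^ 2 * walkSum (X ^ 2) 1 m +
      X * (walkSum (X ^ 2) 0 m + walkSum (X ^ 2) 1 m) := by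
  have h : walkSum (X ^ 2) 0 m + X ^ 2 * walkSum (X ^ 2) 1 m =
      ∑ j ∈ range (m + 1), ((m.choose j * (m + 1).choose j : ℕ) : ℤ[X]) * (X ^ 2) ^ j := by
    rw [walkSum, mul_walkSum_succ, sum_range_succ', sum_range_succ _ m, sum_range_succ']
    have e (j : ℕ) : m.choose (j + 1) * (m + 1).choose (j + 1) =
        m.choose (j + 1 + 0) * m.choose (j + 1) + m.choose (j + 1 + 0) * m.choose j := by
      rw [Nat.choose_succ_succ, add_zero]
      ring
    simp only [e, Nat.cast_add, add_mul, sum_add_distrib]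
    simp
    ring
  rw [h, c, show 2 * m + 1 + 1 = 2 * (m + 1) by ring, sum_range_two_mul, walkSum, walkSum,
    ← sum_add_distrib, mul_sum, ← sum_add_distrib]
  refine sum_congr rfl fun j _ => ?_
  simp only [v, show (2 * (m + 1) - 1) / 2 = m by omega, show 2 * (m + 1) / 2 = m + 1 by omega,
    show 2 * j / 2 = j by omega, show (2 * j + 1) / 2 = j by omega,
    show (2 * j + 1 + 1) / 2 = j + 1 by omega, Nat.choose_succ_succ m j]
  simp
  ring

theorem walkSum_X_sq_comp_neg_X (k m : ℕ) :
    (walkSum (X ^ 2 : ℤ[X]) k m).comp (-X) = walkSum (X ^ 2) k m := by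
  simp [walkSum, Polynomial.sum_comp]

theorem naraNum_succ_zero (m : ℕ) : naraNum (m + 1) 0 = 1 := by
  simp [naraNum]

theorem cast_naraNum_succ_succ (m k : ℕ) :
    (naraNum (m + 1) (k + 1) : ℤ) =
      (m.choose (k + 1) : ℤ) ^ 2 - m.choose k * m.choose (k + 2) := by
  have sub_mul_choose (k : ℕ) : (m.choose (k + 1) : ℤ) * (k + 1) = m.choose k * (m - k) := by
    rcases le_or_gt k m with h | h
    · have := Nat.choose_succ_right_eq m k
      zify [h] at this
      exact this
    · simp [Nat.choose_eq_zero_of_lt h, Nat.choose_eq_zero_of_lt (h.trans k.lt_succ_self)]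
  have h0 := sub_mul_choose k
  have h1 := sub_mul_choose (k + 1)
  rw [naraNum, Nat.add_sub_cancel]
  push_cast at h1 ⊢
  refine Int.ediv_eq_of_eq_mul_left (by positivity) ?_
  rw [Nat.choose_succ_succ]
  push_cast
  linear_combination m.choose k * h1 - m.choose (k + 1) * h0

theorem naraPoly_succ_comp (m : ℕ) (y : ℤ[X]) :
    (naraPoly (m + 1)).comp y = walkSum y 0 m - y * walkSum y 2 m := by
  rw [mul_walkSum_succ, sum_range_succ, walkSum, naraPoly, sum_range_succ', sum_range_succ']
  simp only [cast_naraNum_succ_succ, naraNum_succ_zero]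
  rw [Nat.choose_eq_zero_of_lt (n := m) (k := m + 1 + 1) (by omega)]
  simp only [Polynomial.add_comp, Polynomial.sum_comp]
  simp [sub_mul, add_assoc, one_add_one_eq_two]
  simp [mul_comm, pow_two]
  ring

theorem mk_eq_expand_add {R : Type*} [CommRing R] {f : ℕ → R} {E O : PowerSeries R}
    (hE : ∀ m, f (2 * m) = PowerSeries.coeff m E)
    (hO : ∀ m, f (2 * m + 1) = PowerSeries.coeff m O) :
    PowerSeries.mk f = PowerSeries.expand 2 two_ne_zero E +
      PowerSeries.X * PowerSeries.expand 2 two_ne_zero O := by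
  ext n
  rw [PowerSeries.coeff_mk, map_add]
  rcases Nat.even_or_odd' n with ⟨m, rfl | rfl⟩
  · rw [PowerSeries.coeff_expand_mul, hE]
    rcases m with _ | m
    · simp
    · rw [Nat.mul_succ, PowerSeries.coeff_succ_X_mul,
        PowerSeries.coeff_expand_of_not_dvd _ _ _ (by omega), add_zero]
  · rw [PowerSeries.coeff_succ_X_mul, PowerSeries.coeff_expand_mul, hO,
      PowerSeries.coeff_expand_of_not_dvd _ _ _ (by omega), zero_add]

/-- `c(t,z) · c(-t,-z) = C(t²,z²)`: the coefficient of `z^{2n}` of the product is the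
Narayana polynomial `C_n(t²)` and the odd coefficients vanish. -/
theorem statement12 :
    PowerSeries.mk (fun n => c n) *
        PowerSeries.mk (fun n => (-1) ^ n * (c n).comp (-Polynomial.X)) =
      PowerSeries.mk (fun n =>
        if Even n then (naraPoly (n / 2)).comp (Polynomial.X ^ 2) else 0) := by
  set F := fun k => PowerSeries.mk (walkSum (X ^ 2 : ℤ[X]) k) with hF
  have hcF (k m : ℕ) : PowerSeries.coeff m (F k) = walkSum (X ^ 2) k m := by simp [hF]
  set x : PowerSeries ℤ[X] := PowerSeries.X with hx
  set t : PowerSeries ℤ[X] := PowerSeries.C X with ht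
  set Y : PowerSeries ℤ[X] := PowerSeries.C (X ^ 2) with hY
  have htY : t ^ 2 = Y := (map_pow PowerSeries.C X 2).symm
  have hc := mk_eq_expand_add (f := fun n => c n)
    (E := 1 + x * (F 0 + Y * F 1 + t * (F 0 + F 1))) (O := F 0 + t * F 1)
    (fun m => by
      rcases m with _ | m
      · simp [c, hx]
      · simp only [Nat.mul_succ, c_two_mul_add_two, hx, ht, hY, hcF, map_add,
          PowerSeries.coeff_succ_X_mul, PowerSeries.coeff_one, PowerSeries.coeff_C_mul]
        simp)
    (fun m => by simp only [c_two_mul_add_one, ht, hcF, map_add, PowerSeries.coeff_C_mul])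
  have hc' := mk_eq_expand_add (f := fun n => (-1) ^ n * (c n).comp (-X))
    (E := 1 + x * (F 0 + Y * F 1 - t * (F 0 + F 1))) (O := -F 0 + t * F 1)
    (fun m => by
      rcases m with _ | m
      · simp [c, hx]
      · simp only [Nat.mul_succ, c_two_mul_add_two, hx, ht, hY, hcF, map_add, map_sub,
          PowerSeries.coeff_succ_X_mul, PowerSeries.coeff_one, PowerSeries.coeff_C_mul,
          Polynomial.add_comp, Polynomial.mul_comp, walkSum_X_sq_comp_neg_X]
        simp [pow_add, pow_mul, sub_eq_add_neg])
    (fun m => by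
      simp only [c_two_mul_add_one, ht, hcF, map_add, map_neg, PowerSeries.coeff_C_mul,
        Polynomial.add_comp, Polynomial.mul_comp, walkSum_X_sq_comp_neg_X]
      simp [pow_add, pow_mul, add_comm])
  have hn := mk_eq_expand_add
    (f := fun n => if Even n then (naraPoly (n / 2)).comp (X ^ 2) else 0)
    (E := 1 + x * (F 0 - Y * F 2)) (O := 0)
    (fun m => by
      rcases m with _ | m
      · simp [naraPoly, hx]
      · simp only [hx, hY, hcF, map_add, map_sub, PowerSeries.coeff_succ_X_mul,
          PowerSeries.coeff_one, PowerSeries.coeff_C_mul]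
        simp [naraPoly_succ_comp])
    (fun m => by simp)
  obtain ⟨h1, h2⟩ : (1 + x * (F 0 + Y * F 1)) * F 1 = x * (F 0 + F 1) * F 0 ∧
      (1 + x * (F 0 + Y * F 1)) ^ 2 + x * Y * F 1 ^ 2 - Y * (x * (F 0 + F 1)) ^ 2 - x * F 0 ^ 2 =
        1 + x * (F 0 - Y * F 2) := mk_walkSum_product_identities (X ^ 2)
  replace h1 := congrArg (PowerSeries.expand 2 two_ne_zero) h1
  have hxe : PowerSeries.expand 2 two_ne_zero x = x ^ 2 := PowerSeries.expand_X _ _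
  have hYe : PowerSeries.expand 2 two_ne_zero Y = Y := PowerSeries.expand_C _ _ _
  have hte : PowerSeries.expand 2 two_ne_zero t = t := PowerSeries.expand_C _ _ _
  rw [hc, hc', hn, ← h2]
  simp only [map_add, map_sub, map_mul, map_pow, map_neg, map_one, map_zero, hxe, hYe, hte] at h1 ⊢
  generalize PowerSeries.expand 2 two_ne_zero (F 0) = a at *
  generalize PowerSeries.expand 2 two_ne_zero (F 1) = b at *
  linear_combination 2 * x * t * h1 + (x ^ 2 * b ^ 2 - (x ^ 2 * (a + b)) ^ 2) * htY
end

section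
/- For every n ≥ 0, the shifted Hankel determinant of the polynomials c_m(t) satisfies det((c_{i+j+1}(t))_{i,j=0}^{n-1}) = (-t)^{C(n,2)} in ℤ[t], where C(n,2) = n(n-1)/2. -/
open Polynomial Finset

/-- The polynomial `(1 + z) * ((1 + t * z) * (z + t)) ^ n` in `z` over `ℤ[t]`. -/
noncomputable def walkPoly (n : ℕ) : ℤ[X][X] :=
  (1 + X) * ((1 + C X * X) * (X + C X)) ^ n

theorem walkPoly_succ (n : ℕ) :
    walkPoly (n + 1) = walkPoly n * C X + walkPoly n * C (1 + X ^ 2) * X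
      + walkPoly n * C X * X ^ 2 := by
  simp only [walkPoly, pow_succ, map_add, map_mul, map_one, pow_zero]
  ring

theorem coeff_walkPoly_succ (n i : ℕ) :
    (walkPoly (n + 1)).coeff (i + 2) = X * (walkPoly n).coeff (i + 2)
      + (1 + X ^ 2) * (walkPoly n).coeff (i + 1) + X * (walkPoly n).coeff i := by
  rw [walkPoly_succ]
  simp only [coeff_add, coeff_mul_X_pow, coeff_mul_C]
  rw [show i + 2 = (i + 1) + 1 from rfl, coeff_mul_X, coeff_mul_C]
  ring

theorem coeff_walkPoly_symm (n : ℕ) :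
    ∀ i j, i + j = 2 * n + 1 → (walkPoly n).coeff i = (walkPoly n).coeff j := by
  have hrev : ∀ n, (walkPoly n).reflect (2 * n + 1) = walkPoly n := by
    intro n
    induction n with
    | zero =>
      rw [walkPoly, pow_zero, mul_one, reflect_add]
      simp [reflect_one, reflect_one_X, add_comm]
    | succ n ih =>
      have hq : ((1 + C X * X) * (X + C X) : ℤ[X][X]) =
          C X * X ^ 0 + C (1 + X ^ 2) * X ^ 1 + C X * X ^ 2 := by
        simp only [map_add, map_one, map_pow]; ring
      have hd : ((1 + C X * X) * (X + C X) : ℤ[X][X]).natDegree ≤ 2 := by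
        compute_degree
      have hw : (walkPoly n).natDegree ≤ 2 * n + 1 := by
        rw [walkPoly]
        refine natDegree_mul_le.trans ?_
        have h1 : (1 + X : ℤ[X][X]).natDegree ≤ 1 := by compute_degree
        have h2 := natDegree_pow_le_of_le n hd
        omega
      have : walkPoly (n + 1) = walkPoly n * ((1 + C X * X) * (X + C X)) := by
        rw [walkPoly, walkPoly, pow_succ, mul_assoc]
      rw [this, show 2 * (n + 1) + 1 = (2 * n + 1) + 2 by ring, reflect_mul _ _ hw hd, ih]
      congr 1
      rw [hq]
      simp only [reflect_add, reflect_C_mul_X_pow]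
      rw [revAt_le (by norm_num), revAt_le (by norm_num), revAt_le (by norm_num)]
      norm_num
      ring
  intro i j hij
  conv_lhs => rw [← hrev n]
  rw [coeff_reflect, revAt_le (by omega)]
  congr 1
  omega

theorem coeff_one_add_C_mul_X_pow {R : Type*} [CommSemiring R] (r : R) (n k : ℕ) :
    ((1 + C r * X) ^ n : R[X]).coeff k = r ^ k * n.choose k := by
  have : ((1 + C r * X) ^ n : R[X]) = ((1 + X) ^ n).comp (C r * X) := by simp
  rw [this, comp_C_mul_X_coeff, coeff_one_add_X_pow, mul_comm]

theorem sum_range_two_mul_add_one {M : Type*} [AddCommMonoid M] (f : ℕ → M) (n : ℕ) :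
    ∑ k ∈ range (2 * n + 1), f k =
      ∑ j ∈ range (n + 1), f (2 * j) + ∑ j ∈ range n, f (2 * j + 1) := by
  induction n with
  | zero => simp
  | succ n ih =>
    rw [show 2 * (n + 1) + 1 = 2 * n + 1 + 1 + 1 by ring, sum_range_succ, sum_range_succ, ih,
      sum_range_succ _ (n + 1), sum_range_succ (fun j => f (2 * j + 1)) n, show 2 * n + 1 + 1 = 2 * (n + 1) by ring]
    abel

theorem c_odd (n : ℕ) : c (2 * n + 1) = (walkPoly n).coeff (n + 1) := by
  have h0 : ((1 + C X * X) ^ n * (X + C X) ^ n : ℤ[X][X]).coeff n =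
      ∑ j ∈ range (n + 1), C (v (2 * n + 1) (2 * j) : ℤ) * X ^ (2 * j) := by
    rw [coeff_mul, Nat.sum_antidiagonal_eq_sum_range_succ_mk]
    refine sum_congr rfl fun j hj => ?_
    have hj' : j ≤ n := by simpa [Nat.lt_succ_iff] using hj
    simp only [coeff_one_add_C_mul_X_pow, coeff_X_add_C_pow, v]
    rw [Nat.choose_symm hj', Nat.sub_sub_self hj', show (2 * n + 1 - 1) / 2 = n by omega,
      show (2 * n + 1) / 2 = n by omega, show 2 * j / 2 = j by omega,
      show (2 * j + 1) / 2 = j by omega]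
    push_cast
    simp only [map_mul, map_natCast]
    ring
  have h1 : ((1 + C X * X) ^ n * (X + C X) ^ n : ℤ[X][X]).coeff (n + 1) =
      ∑ j ∈ range n, C (v (2 * n + 1) (2 * j + 1) : ℤ) * X ^ (2 * j + 1) := by
    rw [coeff_mul, Nat.sum_antidiagonal_eq_sum_range_succ_mk, sum_range_succ', sum_range_succ]
    simp only [coeff_one_add_C_mul_X_pow, coeff_X_add_C_pow, v]
    rw [Nat.choose_succ_self]
    simp only [Nat.sub_zero, Nat.choose_succ_self, Nat.cast_zero, mul_zero, zero_mul, add_zero]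
    refine sum_congr rfl fun j hj => ?_
    have hj' : j ≤ n := (mem_range.1 hj).le
    rw [show n + 1 - (j + 1) = n - j by omega, Nat.choose_symm hj', Nat.sub_sub_self hj',
      show (2 * n + 1 - 1) / 2 = n by omega,
      show (2 * n + 1) / 2 = n by omega, show (2 * j + 1) / 2 = j by omega,
      show (2 * j + 1 + 1) / 2 = j + 1 by omega]
    push_cast
    simp only [map_mul, map_natCast]
    ring
  rw [walkPoly, mul_pow, add_mul, one_mul, coeff_add, coeff_X_mul, h0, h1, c,
    sum_range_two_mul_add_one, add_comm]

theorem v_succ_succ (n k : ℕ) :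
    v (2 * n + 2) (k + 1) = v (2 * n + 1) (k + 1) + v (2 * n + 1) k := by
  simp only [v]
  rw [show (2 * n + 2 - 1) / 2 = n by omega, show (2 * n + 2) / 2 = n + 1 by omega,
    show (2 * n + 1 - 1) / 2 = n by omega, show (2 * n + 1) / 2 = n by omega]
  rcases Nat.even_or_odd' k with ⟨j, rfl | rfl⟩
  · rw [show (2 * j + 1) / 2 = j by omega, show (2 * j + 1 + 1) / 2 = j + 1 by omega,
      show 2 * j / 2 = j by omega, Nat.choose_succ_succ]
    ring
  · rw [show (2 * j + 1) / 2 = j by omega, show (2 * j + 1 + 1) / 2 = j + 1 by omega,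
      show (2 * j + 1 + 1 + 1) / 2 = j + 1 by omega, Nat.choose_succ_succ]
    ring

theorem c_even (n : ℕ) : c (2 * n + 2) = (1 + X) * c (2 * n + 1) := by
  have hz : v (2 * n + 1) (2 * n + 1) = 0 := by
    simp only [v]
    rw [show (2 * n + 1 + 1) / 2 = n + 1 by omega, show (2 * n + 1) / 2 = n by omega]
    simp
  have hv : v (2 * n + 2) 0 = v (2 * n + 1) 0 := by simp [v]
  have hc : c (2 * n + 1) =
      ∑ k ∈ range (2 * n + 2), C (v (2 * n + 1) k : ℤ) * X ^ k := by
    rw [sum_range_succ, hz, c]; simp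
  rw [c, sum_range_succ', hv]
  simp only [v_succ_succ, Nat.cast_add, map_add, add_mul, sum_add_distrib, one_mul]
  nth_rewrite 1 [hc]
  rw [sum_range_succ' _ (2 * n + 1), c, mul_sum]
  simp only [pow_succ]
  have : ∀ x ∈ range (2 * n + 1), C (v (2 * n + 1) x : ℤ) * (X ^ x * X) =
      X * (C (v (2 * n + 1) x : ℤ) * X ^ x) := fun x _ => by ring
  rw [sum_congr rfl this]
  ring

/-- The value of the moment functional on `x ^ (2 * n)` times the orthogonal polynomial of
degree `2 * k`. -/
noncomputable def evenMoment (n k : ℕ) : ℤ[X] := X ^ k * (walkPoly n).coeff (n + k + 1)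

theorem evenMoment_zero_right (n : ℕ) : evenMoment n 0 = c (2 * n + 1) := by
  simp [evenMoment, c_odd]

theorem evenMoment_zero_zero : evenMoment 0 0 = 1 := by
  simp [evenMoment, walkPoly, coeff_one]

theorem evenMoment_zero_succ (k : ℕ) : evenMoment 0 (k + 1) = 0 := by
  simp [evenMoment, walkPoly, coeff_one, coeff_X]

theorem evenMoment_succ_zero (n : ℕ) :
    evenMoment (n + 1) 0 = (1 + X + X ^ 2) * evenMoment n 0 + evenMoment n 1 := by
  simp only [evenMoment]
  rw [show n + 1 + 0 + 1 = n + 2 by ring, coeff_walkPoly_succ,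
    coeff_walkPoly_symm n n (n + 1) (by ring)]
  simp only [add_zero, add_assoc]
  ring

theorem evenMoment_succ_succ (n k : ℕ) :
    evenMoment (n + 1) (k + 1) = (1 + X ^ 2) * evenMoment n (k + 1) + evenMoment n (k + 2)
      + X ^ 2 * evenMoment n k := by
  simp only [evenMoment]
  rw [show n + 1 + (k + 1) + 1 = (n + k + 1) + 2 by ring, coeff_walkPoly_succ,
    show n + (k + 1) + 1 = n + k + 1 + 1 by ring, show n + (k + 2) + 1 = n + k + 1 + 2 by ring]
  ring

/-- The value of the moment functional on `x ^ n` times the orthogonal polynomial of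
degree `k`. -/
noncomputable def mixedMoment (n k : ℕ) : ℤ[X] :=
  if k % 2 = 0 then (if n % 2 = 0 then 1 else 1 + X) * evenMoment (n / 2) (k / 2)
  else if n % 2 = 0 then 0
  else evenMoment (n / 2) (k / 2 + 1) - X * evenMoment (n / 2) (k / 2)

theorem mixedMoment_even_even (n k : ℕ) :
    mixedMoment (2 * n) (2 * k) = evenMoment n k := by
  simp [mixedMoment]

theorem mixedMoment_odd_even (n k : ℕ) :
    mixedMoment (2 * n + 1) (2 * k) = (1 + X) * evenMoment n k := by
  simp [mixedMoment, Nat.add_mod, show (2 * n + 1) / 2 = n by omega]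

theorem mixedMoment_even_odd (n k : ℕ) : mixedMoment (2 * n) (2 * k + 1) = 0 := by
  simp [mixedMoment, Nat.add_mod]

theorem mixedMoment_odd_odd (n k : ℕ) :
    mixedMoment (2 * n + 1) (2 * k + 1) = evenMoment n (k + 1) - X * evenMoment n k := by
  simp [mixedMoment, Nat.add_mod, show (2 * n + 1) / 2 = n by omega,
    show (2 * k + 1) / 2 = k by omega]

theorem mixedMoment_zero_right (n : ℕ) : mixedMoment n 0 = c (n + 1) := by
  rcases Nat.even_or_odd' n with ⟨m, rfl | rfl⟩
  · simpa [evenMoment_zero_right] using mixedMoment_even_even m 0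
  · simpa [evenMoment_zero_right, c_even] using mixedMoment_odd_even m 0

theorem mixedMoment_zero_succ (k : ℕ) : mixedMoment 0 (k + 1) = 0 := by
  rcases Nat.even_or_odd' k with ⟨m, rfl | rfl⟩
  · exact mixedMoment_even_odd 0 m
  · exact (mixedMoment_even_even 0 (m + 1)).trans (evenMoment_zero_succ m)

theorem mixedMoment_succ_zero (n : ℕ) :
    mixedMoment (n + 1) 0 = mixedMoment n 1 + (1 + X) * mixedMoment n 0 := by
  rcases Nat.even_or_odd' n with ⟨m, rfl | rfl⟩
  · have h1 := mixedMoment_odd_even m 0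
    have h2 := mixedMoment_even_odd m 0
    have h3 := mixedMoment_even_even m 0
    simp only [mul_zero, zero_add] at h1 h2 h3
    rw [h1, h2, h3]
    ring
  · have h1 := mixedMoment_even_even (m + 1) 0
    have h2 := mixedMoment_odd_odd m 0
    have h3 := mixedMoment_odd_even m 0
    simp only [mul_zero, zero_add, mul_add, mul_one] at h1 h2 h3
    rw [h1, h2, h3, evenMoment_succ_zero]
    ring

theorem mixedMoment_succ_succ (n k : ℕ) :
    mixedMoment (n + 1) (k + 1) = mixedMoment n (k + 2)
      + (-1) ^ (k + 1) * (1 + X) * mixedMoment n (k + 1) - X * mixedMoment n k := by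
  rcases Nat.even_or_odd' n with ⟨m, rfl | rfl⟩ <;> rcases Nat.even_or_odd' k with ⟨l, rfl | rfl⟩
  · rw [show 2 * l + 2 = 2 * (l + 1) by ring, mixedMoment_odd_odd, mixedMoment_even_even,
      mixedMoment_even_odd, mixedMoment_even_even]
    ring
  · rw [show 2 * l + 1 + 2 = 2 * (l + 1) + 1 by ring, show 2 * l + 1 + 1 = 2 * (l + 1) by ring,
      mixedMoment_odd_even, mixedMoment_even_odd, mixedMoment_even_even, mixedMoment_even_odd]
    simp
  · rw [show 2 * l + 2 = 2 * (l + 1) by ring, show 2 * m + 1 + 1 = 2 * (m + 1) by ring,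
      mixedMoment_even_odd, mixedMoment_odd_even, mixedMoment_odd_odd, mixedMoment_odd_even]
    simp only [pow_succ, pow_mul]
    ring
  · rw [show 2 * l + 1 + 2 = 2 * (l + 1) + 1 by ring, show 2 * l + 1 + 1 = 2 * (l + 1) by ring,
      show 2 * m + 1 + 1 = 2 * (m + 1) by ring, mixedMoment_even_even, mixedMoment_odd_odd,
      mixedMoment_odd_even, mixedMoment_odd_odd, evenMoment_succ_succ]
    simp only [pow_mul]
    ring

theorem mixedMoment_eq_zero {n k : ℕ} (h : n < k) : mixedMoment n k = 0 := by
  induction n generalizing k with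
  | zero =>
    obtain ⟨k, rfl⟩ := Nat.exists_eq_succ_of_ne_zero h.ne'
    exact mixedMoment_zero_succ k
  | succ n ih =>
    obtain ⟨k, rfl⟩ := Nat.exists_eq_succ_of_ne_zero (Nat.ne_zero_of_lt h)
    rw [Nat.succ_eq_add_one, mixedMoment_succ_succ, ih (by omega), ih (by omega), ih (by omega)]
    simp

theorem mixedMoment_self (n : ℕ) : mixedMoment n n = (-X) ^ n := by
  induction n with
  | zero => simpa [evenMoment_zero_zero] using mixedMoment_even_even 0 0
  | succ n ih =>
    rw [mixedMoment_succ_succ, mixedMoment_eq_zero (by omega), mixedMoment_eq_zero (by omega), ih]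
    ring

/-- The monic orthogonal polynomials for the moments `c (n + 1)`. -/
noncomputable def orthoPoly : ℕ → ℤ[X][X]
  | 0 => 1
  | 1 => X - C (1 + X)
  | k + 2 => (X - C ((-1) ^ (k + 1) * (1 + X))) * orthoPoly (k + 1) + C X * orthoPoly k

theorem orthoPoly_monic_natDegree (k : ℕ) :
    (orthoPoly k).Monic ∧ (orthoPoly k).natDegree = k := by
  induction k using Nat.twoStepInduction with
  | zero => simp [orthoPoly]
  | one => exact ⟨monic_X_sub_C _, natDegree_X_sub_C _⟩
  | more k ih0 ih1 =>
    rw [orthoPoly]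
    set a : ℤ[X] := (-1) ^ (k + 1) * (1 + X)
    have hm : ((X - C a) * orthoPoly (k + 1)).Monic := (monic_X_sub_C a).mul ih1.1
    have hd : ((X - C a) * orthoPoly (k + 1)).natDegree = k + 2 := by
      rw [(monic_X_sub_C a).natDegree_mul ih1.1, natDegree_X_sub_C, ih1.2]
      ring
    have hlt : (C X * orthoPoly k).natDegree < ((X - C a) * orthoPoly (k + 1)).natDegree := by
      rw [hd]
      have := natDegree_C_mul_le (X : ℤ[X]) (orthoPoly k)
      omega
    exact ⟨hm.add_of_left (degree_lt_degree hlt),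
      (natDegree_add_eq_left_of_natDegree_lt hlt).trans hd⟩

/-- The linear functional on polynomials whose `n`-th moment is `c (n + 1)`. -/
noncomputable def momentFunctional : ℤ[X][X] →ₗ[ℤ[X]] ℤ[X] :=
  Polynomial.lsum fun n => LinearMap.mulRight ℤ[X] (c (n + 1))

theorem momentFunctional_C_mul_X_pow (a : ℤ[X]) (n : ℕ) :
    momentFunctional (C a * X ^ n) = a * c (n + 1) := by
  simp [momentFunctional, Polynomial.lsum_apply, C_mul_X_pow_eq_monomial, sum_monomial_index]

theorem momentFunctional_C_mul (a : ℤ[X]) (p : ℤ[X][X]) :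
    momentFunctional (C a * p) = a * momentFunctional p := by
  rw [C_mul', map_smul, smul_eq_mul]

theorem momentFunctional_X_pow_mul_orthoPoly (i k : ℕ) :
    momentFunctional (X ^ i * orthoPoly k) = mixedMoment i k := by
  induction k using Nat.twoStepInduction generalizing i with
  | zero =>
    rw [orthoPoly, mixedMoment_zero_right]
    simpa using momentFunctional_C_mul_X_pow 1 i
  | one =>
    have h (i : ℕ) : momentFunctional (X ^ i) = mixedMoment i 0 := by
      rw [mixedMoment_zero_right]
      simpa using momentFunctional_C_mul_X_pow 1 i
    have : (X ^ i * orthoPoly 1 : ℤ[X][X]) = X ^ (i + 1) - C (1 + X) * X ^ i := by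
      rw [orthoPoly]; ring
    rw [this, map_sub, momentFunctional_C_mul, h, h, mixedMoment_succ_zero]
    ring
  | more k ih0 ih1 =>
    have : (X ^ i * orthoPoly (k + 2) : ℤ[X][X]) = X ^ (i + 1) * orthoPoly (k + 1)
        - C ((-1) ^ (k + 1) * (1 + X)) * (X ^ i * orthoPoly (k + 1))
        + C X * (X ^ i * orthoPoly k) := by
      rw [orthoPoly]; ring
    rw [this, map_add, map_sub, momentFunctional_C_mul, momentFunctional_C_mul, ih0, ih1, ih1,
      mixedMoment_succ_succ]
    ring

theorem sum_coeff_orthoPoly_mul_c {n k : ℕ} (hk : k < n) (i : ℕ) :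
    ∑ j : Fin n, c (i + j + 1) * (orthoPoly k).coeff j = mixedMoment i k := by
  have hp := (orthoPoly k).as_sum_range_C_mul_X_pow' (by rwa [(orthoPoly_monic_natDegree k).2])
  rw [← momentFunctional_X_pow_mul_orthoPoly]
  conv_rhs => rw [hp]
  rw [mul_sum, map_sum, Fin.sum_univ_eq_sum_range fun j => c (i + j + 1) * (orthoPoly k).coeff j]
  refine sum_congr rfl fun j _ => ?_
  rw [show (X ^ i * (C ((orthoPoly k).coeff j) * X ^ j) : ℤ[X][X]) =
    C ((orthoPoly k).coeff j) * X ^ (i + j) by ring, momentFunctional_C_mul_X_pow, mul_comm]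

/-- The shifted Hankel determinant `det (c_{i+j+1}(t))_{i,j=0}^{n-1} = (-t)^{C(n,2)}`. -/
theorem statement16 (n : ℕ) :
    Matrix.det (Matrix.of fun i j : Fin n => c ((i : ℕ) + (j : ℕ) + 1)) =
      (-Polynomial.X) ^ Nat.choose n 2 := by
  set H := Matrix.of fun i j : Fin n => c ((i : ℕ) + (j : ℕ) + 1)
  let A : Matrix (Fin n) (Fin n) ℤ[X] := Matrix.of fun j k => (orthoPoly k).coeff j
  have hA : A.det = 1 := by
    rw [Matrix.det_of_isUpperTriangular]
    · refine prod_eq_one fun k _ => ?_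
      have h := orthoPoly_monic_natDegree k
      have := h.1.coeff_natDegree
      rwa [h.2] at this
    · intro j k hjk
      refine coeff_eq_zero_of_natDegree_lt ?_
      rw [(orthoPoly_monic_natDegree k).2]
      exact hjk
  have hHA : H * A = Matrix.of fun i k : Fin n => mixedMoment i k := by
    ext1 i k
    exact sum_coeff_orthoPoly_mul_c k.2 i
  have hdet : (H * A).det = (-X) ^ Nat.choose n 2 := by
    rw [hHA, Matrix.det_of_isLowerTriangular]
    · simp only [Matrix.of_apply, mixedMoment_self]
      rw [prod_pow_eq_pow_sum, Fin.sum_univ_eq_sum_range fun i => i, sum_range_id,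
        Nat.choose_two_right]
    · intro i k hik
      exact mixedMoment_eq_zero hik
  rwa [Matrix.det_mul, hA, mul_one] at hdet
end

section
/- For every n ≥ 0, the Hankel determinants of the Narayana polynomials satisfy det((C_{i+j}(t))_{i,j=0}^{n-1}) = t^{C(n,2)} and det((C_{i+j+1}(t))_{i,j=0}^{n-1}) = t^{C(n,2)} in ℤ[t], where C(n,2) = n(n-1)/2. -/
open Polynomial Finset

/-- Weighted Motzkin paths from height `0` to height `k` in `n` steps: up steps have weight `1`,
down steps have weight `t`, level steps have weight `c` at height `0` and `1 + t` above. -/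
def motzkinWeight {R : Type*} [CommRing R] (c t : R) : ℕ → ℕ → R
  | 0, 0 => 1
  | 0, _ + 1 => 0
  | n + 1, 0 => c * motzkinWeight c t n 0 + t * motzkinWeight c t n 1
  | n + 1, k + 1 => motzkinWeight c t n k + (1 + t) * motzkinWeight c t n (k + 1) +
      t * motzkinWeight c t n (k + 2)

section Motzkin

variable {R : Type*} [CommRing R] (c t : R)

theorem motzkinWeight_eq_zero_of_lt {n k : ℕ} (h : n < k) : motzkinWeight c t n k = 0 := by
  induction n generalizing k with
  | zero => obtain ⟨k, rfl⟩ := Nat.exists_eq_succ_of_ne_zero h.ne'; rfl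
  | succ n ih =>
    obtain ⟨k, rfl⟩ := Nat.exists_eq_succ_of_ne_zero (Nat.ne_zero_of_lt h)
    simp [motzkinWeight, ih (show n < k by omega), ih (show n < k + 1 by omega),
      ih (show n < k + 2 by omega)]

theorem motzkinWeight_self (n : ℕ) : motzkinWeight c t n n = 1 := by
  induction n with
  | zero => rfl
  | succ n ih =>
    simp [motzkinWeight, ih, motzkinWeight_eq_zero_of_lt c t (show n < n + 1 by omega),
      motzkinWeight_eq_zero_of_lt c t (show n < n + 2 by omega)]

/-- A Christoffel–Darboux type identity for the weights. -/
theorem sum_motzkinWeight_succ_mul (m n N : ℕ) :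
    ∑ k ∈ range (N + 1), motzkinWeight c t (m + 1) k * motzkinWeight c t n k * t ^ k =
      ∑ k ∈ range (N + 1), motzkinWeight c t m k * motzkinWeight c t (n + 1) k * t ^ k +
        t ^ (N + 1) * (motzkinWeight c t m (N + 1) * motzkinWeight c t n N -
          motzkinWeight c t m N * motzkinWeight c t n (N + 1)) := by
  induction N with
  | zero => simp [motzkinWeight]; ring
  | succ N ih =>
    rw [sum_range_succ, ih, sum_range_succ _ (N + 1)]
    simp only [motzkinWeight]
    ring

theorem sum_motzkinWeight_mul {m N : ℕ} (h : m < N) (n : ℕ) :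
    ∑ k ∈ range N, motzkinWeight c t m k * motzkinWeight c t n k * t ^ k =
      motzkinWeight c t (m + n) 0 := by
  obtain ⟨N, rfl⟩ := Nat.exists_eq_succ_of_ne_zero (Nat.ne_zero_of_lt h)
  induction m generalizing n with
  | zero => simp [sum_range_succ', motzkinWeight]
  | succ m ih =>
    rw [Nat.succ_eq_add_one, sum_motzkinWeight_succ_mul,
      motzkinWeight_eq_zero_of_lt c t (show m < N by omega),
      motzkinWeight_eq_zero_of_lt c t (show m < N + 1 by omega), ← Nat.succ_eq_add_one N,
      ih _ (by omega), show m + (n + 1) = m + 1 + n by omega]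
    ring

theorem det_hankel_motzkinWeight (n : ℕ) :
    (Matrix.of fun i j : Fin n => motzkinWeight c t (i + j) 0).det = t ^ n.choose 2 := by
  let L : Matrix (Fin n) (Fin n) R := Matrix.of fun i j => motzkinWeight c t i j
  have hL : L.det = 1 := by
    rw [Matrix.det_of_isLowerTriangular L]
    · simp [L, motzkinWeight_self]
    · exact fun i j hij => motzkinWeight_eq_zero_of_lt c t hij
  have hM : (Matrix.of fun i j : Fin n => motzkinWeight c t (i + j) 0) =
      L * Matrix.diagonal (fun k : Fin n => t ^ (k : ℕ)) * L.transpose := by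
    ext i j
    rw [Matrix.mul_apply, Matrix.of_apply, ← sum_motzkinWeight_mul c t i.2,
      ← Fin.sum_univ_eq_sum_range
      (fun k => motzkinWeight c t i k * motzkinWeight c t j k * t ^ k)]
    refine sum_congr rfl fun k _ => ?_
    simp only [L, Matrix.mul_diagonal, Matrix.transpose_apply, Matrix.of_apply]
    ring
  rw [hM, Matrix.det_mul, Matrix.det_mul, Matrix.det_transpose, hL, Matrix.det_diagonal,
    prod_pow_eq_pow_sum, Fin.sum_univ_eq_sum_range (fun k => k), sum_range_id,
    Nat.choose_two_right, one_mul, mul_one]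

/-- Comparison of the ground-level weights `1 + t` and `1`. -/
theorem motzkinWeight_one_add_eq (n k : ℕ) :
    motzkinWeight (1 + t) t n k =
      motzkinWeight 1 t n k + t * motzkinWeight 1 t n (k + 1) := by
  induction n generalizing k with
  | zero => cases k <;> simp [motzkinWeight]
  | succ n ih => cases k <;> simp only [motzkinWeight, ih] <;> ring

end Motzkin

/-- The weights are given by the reflection principle. -/
theorem coeff_motzkinWeight (n k j : ℕ) :
    (motzkinWeight (1 + X) (X : ℤ[X]) n k).coeff j =
      n.choose j * n.choose (j + k) -
        if j = 0 then 0 else (n.choose (j - 1) * n.choose (j + k + 1) : ℤ) := by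
  induction n generalizing k j with
  | zero => rcases k with _ | k <;> rcases j with _ | j <;> simp [motzkinWeight, coeff_one]
  | succ n ih =>
    rcases k with _ | k <;> rcases j with _ | _ | j <;>
      simp [motzkinWeight, add_mul, ih, Nat.choose_succ_succ', coeff_X_mul, ← add_assoc,
        add_right_comm _ 1] <;> ring

theorem naraNum_succ (n k : ℕ) :
    (naraNum (n + 1) k : ℤ) =
      n.choose k * n.choose k -
        if k = 0 then 0 else (n.choose (k - 1) * n.choose (k + 1) : ℤ) := by
  have choose_step (i : ℕ) : (n.choose (i + 1) * (i + 1) : ℤ) = n.choose i * (n - i) := by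
    rcases le_or_gt i n with h | h
    · have := Nat.choose_succ_right_eq n i
      zify [h] at this
      exact this
    · simp [Nat.choose_eq_zero_of_lt h, Nat.choose_eq_zero_of_lt (h.trans (Nat.lt_succ_self i))]
  rw [naraNum, Nat.add_sub_cancel]
  push_cast
  refine Int.ediv_eq_of_eq_mul_right (by positivity) ?_
  rcases k with _ | i
  · simp
  · have h₁ := choose_step i
    have h₂ := choose_step (i + 1)
    rw [if_neg i.succ_ne_zero, Nat.choose_succ_succ', Nat.add_sub_cancel]
    push_cast at h₂ ⊢
    linear_combination n.choose i * h₂ - n.choose (i + 1) * h₁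

theorem naraPoly_succ_eq_motzkinWeight (n : ℕ) :
    naraPoly (n + 1) = motzkinWeight (1 + X) X n 0 := by
  ext k
  rw [coeff_naraPoly_succ, naraNum_succ, coeff_motzkinWeight, add_zero]

theorem naraPoly_eq_motzkinWeight (n : ℕ) : naraPoly n = motzkinWeight 1 X n 0 := by
  cases n with
  | zero => rfl
  | succ n =>
    rw [naraPoly_succ_eq_motzkinWeight, motzkinWeight_one_add_eq, motzkinWeight, one_mul]

/-- The Hankel determinants of the Narayana polynomials:
`det (C_{i+j}(t)) = det (C_{i+j+1}(t)) = t^{C(n,2)}` in `ℤ[t]`. -/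
theorem statement17 (n : ℕ) :
    Matrix.det (Matrix.of fun i j : Fin n => naraPoly ((i : ℕ) + (j : ℕ))) =
        Polynomial.X ^ Nat.choose n 2 ∧
      Matrix.det (Matrix.of fun i j : Fin n => naraPoly ((i : ℕ) + (j : ℕ) + 1)) =
        Polynomial.X ^ Nat.choose n 2 := by
  simp only [naraPoly_succ_eq_motzkinWeight]
  simp only [naraPoly_eq_motzkinWeight]
  exact ⟨det_hankel_motzkinWeight _ _ n, det_hankel_motzkinWeight _ _ n⟩
end
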